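/- Let Λ = (λ_1,…,λ_n), λ_i ∈ ℝ^k, be weakly hyperbolic, let Λ' = (λ_1, λ_1, λ_2, …, λ_n), and write Z' = Z(Λ') ⊆ ℝ^{n+1} with coordinates (x_0, x_1, …, x_n). Set Z_+ = Z(Λ) ∩ {x_1 ≥ 0} and let S¹ = {(u_0,u_1) ∈ ℝ² : u_0² + u_1² = 1}. Then the map Φ : Z_+ × S¹ → Z' defined by Φ((x_1,…,x_n),(u_0,u_1)) = (x_1 u_0, x_1 u_1, x_2, …, x_n) is a continuous surjection onto Z' satisfying Φ(p,u) = Φ(q,u') if and only if p = q and (u = u' or p_1 = 0); consequently Φ descends to a homeomorphism onto Z' from the quotient space of Z_+ × S¹ by the equivalence relation identifying (p,u) with (p,u') whenever p_1 = 0. (This is the open book decomposition of Z' with page Z_+, binding Z_0 = Z(Λ) ∩ {x_1 = 0}, and trivial monodromy.) -/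

import Mathlib

open scoped BigOperators

/-- The intersection of quadrics `Z(Λ)` for a configuration `Λ` of vectors in `ℝ^k`. -/
def ZReal {n k : ℕ} (Λ : Fin n → Fin k → ℝ) : Set (Fin n → ℝ) :=
  {x | (∑ i, (x i) ^ 2 • Λ i) = 0 ∧ (∑ i, (x i) ^ 2) = 1}

/-- `Λ` is weakly hyperbolic: for every subset `J` with at most `k` elements,
the origin is not in the convex hull of the `λ_i`, `i ∈ J`. -/
def WeaklyHyperbolic {n k : ℕ} (Λ : Fin n → Fin k → ℝ) : Prop :=
  ∀ J : Finset (Fin n), J.card ≤ k → (0 : Fin k → ℝ) ∉ convexHull ℝ (Λ '' ↑J)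

/-- `Λ' = (λ_1, λ_1, λ_2, …, λ_n)`: the configuration with `λ_1` repeated. -/
def doubled {n k : ℕ} (Λ : Fin (n + 1) → Fin k → ℝ) : Fin (n + 2) → Fin k → ℝ :=
  Fin.cons (Λ 0) Λ

/-- The half manifold `Z_+ = Z(Λ) ∩ {x_1 ≥ 0}`. -/
def ZPlus {n k : ℕ} (Λ : Fin (n + 1) → Fin k → ℝ) : Set (Fin (n + 1) → ℝ) :=
  {x | x ∈ ZReal Λ ∧ 0 ≤ x 0}

/-- The circle `S¹ = {(u₀,u₁) ∈ ℝ² : u₀² + u₁² = 1}`. -/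
def circleSet : Set (ℝ × ℝ) := {u | u.1 ^ 2 + u.2 ^ 2 = 1}

/-- `Φ((x_1,…,x_n),(u_0,u_1)) = (x_1 u_0, x_1 u_1, x_2, …, x_n)`, where the coordinates of
`ℝ^{n+1}` are `(x_0, x_1, …, x_n)` (index `0 ↦ x_0`, index `i+1 ↦ x_i`). -/
def pageMap {n : ℕ} (x : Fin (n + 1) → ℝ) (u : ℝ × ℝ) : Fin (n + 2) → ℝ :=
  Fin.cons (x 0 * u.1) (fun i => if i = 0 then x 0 * u.2 else x i)

/-- The relation on `Z_+ × S¹` identifying `(p,u)` with `(p,u')` whenever `p_1 = 0`. -/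
def pageRel {n k : ℕ} (Λ : Fin (n + 1) → Fin k → ℝ) :
    (↥(ZPlus Λ) × ↥circleSet) → (↥(ZPlus Λ) × ↥circleSet) → Prop :=
  fun a b => a.1 = b.1 ∧ (a.2 = b.2 ∨ a.1.1 0 = 0)

theorem pageMap_zero {n : ℕ} (x : Fin (n + 1) → ℝ) (u : ℝ × ℝ) :
    pageMap x u 0 = x 0 * u.1 := rfl

theorem pageMap_one {n : ℕ} (x : Fin (n + 1) → ℝ) (u : ℝ × ℝ) :
    pageMap x u 1 = x 0 * u.2 := rfl

theorem pageMap_succ_succ {n : ℕ} (x : Fin (n + 1) → ℝ) (u : ℝ × ℝ) (i : Fin n) :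
    pageMap x u i.succ.succ = x i.succ := by
  simp [pageMap]

theorem mem_ZReal_doubled_iff {n k : ℕ} (Λ : Fin (n + 1) → Fin k → ℝ) (y : Fin (n + 2) → ℝ) :
    y ∈ ZReal (doubled Λ) ↔
      (y 0 ^ 2 + y 1 ^ 2) • Λ 0 + ∑ i : Fin n, y i.succ.succ ^ 2 • Λ i.succ = 0 ∧
        y 0 ^ 2 + y 1 ^ 2 + ∑ i : Fin n, y i.succ.succ ^ 2 = 1 := by
  simp [ZReal, doubled, Fin.sum_univ_succ, add_smul, add_assoc]

theorem mem_ZReal_succ_iff {n k : ℕ} (Λ : Fin (n + 1) → Fin k → ℝ) (x : Fin (n + 1) → ℝ) :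
    x ∈ ZReal Λ ↔
      x 0 ^ 2 • Λ 0 + ∑ i : Fin n, x i.succ ^ 2 • Λ i.succ = 0 ∧
        x 0 ^ 2 + ∑ i : Fin n, x i.succ ^ 2 = 1 := by
  simp [ZReal, Fin.sum_univ_succ]

theorem pageMap_sq_add_sq {n : ℕ} (x : Fin (n + 1) → ℝ) {u : ℝ × ℝ} (hu : u ∈ circleSet) :
    pageMap x u 0 ^ 2 + pageMap x u 1 ^ 2 = x 0 ^ 2 := by
  have hu' : u.1 ^ 2 + u.2 ^ 2 = 1 := hu
  rw [pageMap_zero, pageMap_one]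
  linear_combination x 0 ^ 2 * hu'

theorem pageMap_mem_ZReal_doubled_iff {n k : ℕ} (Λ : Fin (n + 1) → Fin k → ℝ)
    (x : Fin (n + 1) → ℝ) {u : ℝ × ℝ} (hu : u ∈ circleSet) :
    pageMap x u ∈ ZReal (doubled Λ) ↔ x ∈ ZReal Λ := by
  rw [mem_ZReal_doubled_iff, mem_ZReal_succ_iff]
  simp only [pageMap_sq_add_sq x hu, pageMap_succ_succ]

theorem continuous_pageMap {n : ℕ} :
    Continuous (fun a : (Fin (n + 1) → ℝ) × (ℝ × ℝ) => pageMap a.1 a.2) := by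
  refine continuous_pi fun i => ?_
  induction i using Fin.cases with
  | zero => simp only [pageMap_zero]; fun_prop
  | succ i =>
    induction i using Fin.cases with
    | zero => simp only [Fin.succ_zero_eq_one, pageMap_one]; fun_prop
    | succ i => simp only [pageMap_succ_succ]; fun_prop

/-- Polar coordinates in the plane, allowing the radius to vanish. -/
theorem exists_circleSet_polar (a b : ℝ) :
    ∃ u ∈ circleSet, √(a ^ 2 + b ^ 2) * u.1 = a ∧ √(a ^ 2 + b ^ 2) * u.2 = b := by
  have hsq : √(a ^ 2 + b ^ 2) ^ 2 = a ^ 2 + b ^ 2 := Real.sq_sqrt (by positivity)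
  by_cases h : √(a ^ 2 + b ^ 2) = 0
  · rw [h] at hsq ⊢
    have ha : a = 0 := by nlinarith [sq_nonneg a, sq_nonneg b]
    have hb : b = 0 := by nlinarith [sq_nonneg a, sq_nonneg b]
    exact ⟨(1, 0), by simp [circleSet], by simp [ha], by simp [hb]⟩
  · refine ⟨(a / √(a ^ 2 + b ^ 2), b / √(a ^ 2 + b ^ 2)), ?_, mul_div_cancel₀ _ h,
      mul_div_cancel₀ _ h⟩
    change (a / √(a ^ 2 + b ^ 2)) ^ 2 + (b / √(a ^ 2 + b ^ 2)) ^ 2 = 1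
    rw [div_pow, div_pow, ← add_div, hsq, div_self]
    rw [← hsq]
    exact pow_ne_zero 2 h

theorem exists_pageMap_eq {n k : ℕ} (Λ : Fin (n + 1) → Fin k → ℝ) {y : Fin (n + 2) → ℝ}
    (hy : y ∈ ZReal (doubled Λ)) : ∃ p ∈ ZPlus Λ, ∃ u ∈ circleSet, pageMap p u = y := by
  obtain ⟨u, hu, h0, h1⟩ := exists_circleSet_polar (y 0) (y 1)
  let p : Fin (n + 1) → ℝ := Fin.cons √(y 0 ^ 2 + y 1 ^ 2) fun i => y i.succ.succ
  have hpy : pageMap p u = y := by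
    funext i
    induction i using Fin.cases with
    | zero => exact h0
    | succ i =>
      induction i using Fin.cases with
      | zero => exact h1
      | succ i => exact pageMap_succ_succ p u i
  exact ⟨p, ⟨(pageMap_mem_ZReal_doubled_iff Λ p hu).1 (hpy ▸ hy), Real.sqrt_nonneg _⟩, u, hu, hpy⟩

theorem pageMap_eq_pageMap_iff {n : ℕ} {p q : Fin (n + 1) → ℝ} {u v : ℝ × ℝ}
    (hp : 0 ≤ p 0) (hq : 0 ≤ q 0) (hu : u ∈ circleSet) (hv : v ∈ circleSet) :
    pageMap p u = pageMap q v ↔ p = q ∧ (u = v ∨ p 0 = 0) := by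
  constructor
  · intro h
    have h0 : p 0 = q 0 := by
      rw [← sq_eq_sq₀ hp hq, ← pageMap_sq_add_sq p hu, ← pageMap_sq_add_sq q hv, h]
    have hpq : p = q := by
      funext i
      induction i using Fin.cases with
      | zero => exact h0
      | succ i => simpa only [pageMap_succ_succ] using congrFun h i.succ.succ
    subst hpq
    refine ⟨rfl, or_iff_not_imp_right.2 fun hne => Prod.ext ?_ ?_⟩
    · exact mul_left_cancel₀ hne (congrFun h 0)
    · exact mul_left_cancel₀ hne (congrFun h 1)
  · rintro ⟨rfl, rfl | h⟩
    · rfl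
    · simp [pageMap, h]

theorem isCompact_ZReal {n k : ℕ} (Λ : Fin n → Fin k → ℝ) : IsCompact (ZReal Λ) := by
  refine (isCompact_univ_pi fun _ => isCompact_Icc (a := (-1 : ℝ)) (b := 1)).of_isClosed_subset
    ?_ ?_
  · exact (isClosed_eq (by fun_prop) continuous_const).inter
      (isClosed_eq (by fun_prop) continuous_const)
  · intro x hx i _
    have h : x i ^ 2 ≤ 1 := hx.2 ▸
      Finset.single_le_sum (f := fun j => x j ^ 2) (fun j _ => sq_nonneg (x j)) (Finset.mem_univ i)
    exact abs_le.1 (sq_le_one_iff_abs_le_one _ |>.1 h)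

theorem isCompact_ZPlus {n k : ℕ} (Λ : Fin (n + 1) → Fin k → ℝ) : IsCompact (ZPlus Λ) :=
  (isCompact_ZReal Λ).inter_right (isClosed_le continuous_const (continuous_apply 0))

theorem isCompact_circleSet : IsCompact circleSet := by
  refine (isCompact_Icc (a := (-1 : ℝ)) (b := 1)).prod
    (isCompact_Icc (a := (-1 : ℝ)) (b := 1)) |>.of_isClosed_subset
    (isClosed_eq (by fun_prop) continuous_const) ?_
  intro u hu
  have hu' : u.1 ^ 2 + u.2 ^ 2 = 1 := hu
  exact ⟨abs_le.1 (sq_le_one_iff_abs_le_one _ |>.1 (by nlinarith [sq_nonneg u.2])),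
    abs_le.1 (sq_le_one_iff_abs_le_one _ |>.1 (by nlinarith [sq_nonneg u.1]))⟩

/-- Open book decomposition of `Z' = Z(Λ')`, with page `Z_+` and trivial monodromy:
`Φ` is a continuous surjection from `Z_+ × S¹` onto `Z'`, satisfying
`Φ(p,u) = Φ(q,u') ↔ p = q ∧ (u = u' ∨ p_1 = 0)`, and it descends to a homeomorphism onto
`Z'` from the quotient of `Z_+ × S¹` by the corresponding equivalence relation. -/
theorem openBook_real {n k : ℕ} (hk : 1 ≤ k)
    (Λ : Fin (n + 1) → Fin k → ℝ) (hΛ : WeaklyHyperbolic Λ) :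
    (∀ p ∈ ZPlus Λ, ∀ u ∈ circleSet, pageMap p u ∈ ZReal (doubled Λ)) ∧
    Continuous (fun a : ↥(ZPlus Λ) × ↥circleSet => pageMap a.1.1 a.2.1) ∧
    (∀ y ∈ ZReal (doubled Λ), ∃ p ∈ ZPlus Λ, ∃ u ∈ circleSet, pageMap p u = y) ∧
    (∀ a b : ↥(ZPlus Λ) × ↥circleSet,
      pageMap a.1.1 a.2.1 = pageMap b.1.1 b.2.1 ↔
        (a.1 = b.1 ∧ (a.2 = b.2 ∨ a.1.1 0 = 0))) ∧
    (∃ H : Quot (pageRel Λ) ≃ₜ ↥(ZReal (doubled Λ)),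
      ∀ a : ↥(ZPlus Λ) × ↥circleSet,
        (H (Quot.mk (pageRel Λ) a) : Fin (n + 2) → ℝ) = pageMap a.1.1 a.2.1) := by
  have hmem : ∀ p ∈ ZPlus Λ, ∀ u ∈ circleSet, pageMap p u ∈ ZReal (doubled Λ) :=
    fun p hp u hu => (pageMap_mem_ZReal_doubled_iff Λ p hu).2 hp.1
  have hcont : Continuous (fun a : ↥(ZPlus Λ) × ↥circleSet => pageMap a.1.1 a.2.1) :=
    continuous_pageMap.comp (by fun_prop :
      Continuous fun a : ↥(ZPlus Λ) × ↥circleSet => (a.1.1, a.2.1))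
  have hiff : ∀ a b : ↥(ZPlus Λ) × ↥circleSet,
      pageMap a.1.1 a.2.1 = pageMap b.1.1 b.2.1 ↔
        (a.1 = b.1 ∧ (a.2 = b.2 ∨ a.1.1 0 = 0)) := fun a b => by
    rw [pageMap_eq_pageMap_iff a.1.2.2 b.1.2.2 a.2.2 b.2.2, Subtype.ext_iff, Subtype.ext_iff]
  refine ⟨hmem, hcont, fun y hy => exists_pageMap_eq Λ hy, hiff, ?_⟩
  let F : Quot (pageRel Λ) → ↥(ZReal (doubled Λ)) :=
    Quot.lift (fun a => ⟨pageMap a.1.1 a.2.1, hmem _ a.1.2 _ a.2.2⟩)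
      fun a b h => Subtype.ext ((hiff a b).2 h)
  have hF : Function.Bijective F := by
    constructor
    · rintro ⟨a⟩ ⟨b⟩ h
      exact Quot.sound ((hiff a b).1 (congrArg Subtype.val h))
    · rintro ⟨y, hy⟩
      obtain ⟨p, hp, u, hu, h⟩ := exists_pageMap_eq Λ hy
      exact ⟨Quot.mk _ (⟨p, hp⟩, ⟨u, hu⟩), Subtype.ext h⟩
  have hFcont : Continuous F := continuous_quot_lift _ (hcont.subtype_mk _)
  have := isCompact_iff_compactSpace.1 (isCompact_ZPlus Λ)
  have := isCompact_iff_compactSpace.1 isCompact_circleSet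
  exact ⟨Continuous.homeoOfEquivCompactToT2 (f := Equiv.ofBijective F hF) hFcont, fun a => rfl⟩
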